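/- Let L > 0. For every c > 4π²/L² there exists a unique η ∈ (2c/√3, 2c) such that G(η,c) = L. Moreover, the function Γ : (4π²/L², ∞) → ℝ assigning to each c this unique η is infinitely differentiable, and G(Γ(c), c) = L for all c > 4π²/L². -/

import Mathlib

open Real

/-- r(η,c) = 16c²η² − 3η⁴. -/
noncomputable def rfun (η c : ℝ) : ℝ := 16 * c ^ 2 * η ^ 2 - 3 * η ^ 4

/-- The elliptic modulus κ(η,c) = √((3η² − 8c² + √r)/(2√r)). -/
noncomputable def kfun (η c : ℝ) : ℝ :=
  Real.sqrt ((3 * η ^ 2 - 8 * c ^ 2 + Real.sqrt (rfun η c)) / (2 * Real.sqrt (rfun η c)))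

/-- The complete elliptic integral of the first kind. -/
noncomputable def Kell (m : ℝ) : ℝ :=
  ∫ θ in (0:ℝ)..(Real.pi / 2), 1 / Real.sqrt (1 - m ^ 2 * Real.sin θ ^ 2)

/-- The fundamental period G(η,c) = 8√c·K(κ(η,c))/r(η,c)^{1/4} of the traveling wave. -/
noncomputable def Gfun (η c : ℝ) : ℝ :=
  8 * Real.sqrt c * Kell (kfun η c) / (rfun η c) ^ ((1 : ℝ) / 4)

open Set Filter Topology MeasureTheory

/-- Differentiation under the integral sign for jointly continuous data. -/
lemma hasDerivAt_intervalIntegral_of_continuousOn {F F' : ℝ → ℝ → ℝ} {U : Set ℝ} (hU : IsOpen U)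
    (hF : ∀ x ∈ U, Continuous (F x))
    (hF' : ContinuousOn (Function.uncurry F') (U ×ˢ univ))
    (hd : ∀ x ∈ U, ∀ t, HasDerivAt (fun x => F x t) (F' x t) x) (a b : ℝ) {x₀ : ℝ} (hx₀ : x₀ ∈ U) :
    HasDerivAt (fun x => ∫ t in a..b, F x t) (∫ t in a..b, F' x₀ t) x₀ := by
  obtain ⟨ε, hε, hball⟩ := Metric.nhds_basis_closedBall.mem_iff.1 (hU.mem_nhds hx₀)
  obtain ⟨C, hC⟩ := ((isCompact_closedBall x₀ ε).prod isCompact_uIcc).exists_bound_of_continuousOn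
    (hF'.mono (prod_mono hball (subset_univ (uIcc a b))))
  have hF'x : Continuous (F' x₀) := by
    rw [← continuousOn_univ]
    exact hF'.comp (f := fun t : ℝ => (x₀, t)) (by fun_prop) fun t _ => ⟨hx₀, mem_univ t⟩
  refine (intervalIntegral.hasDerivAt_integral_of_dominated_loc_of_deriv_le (F := F) (F' := F')
    (bound := fun _ => C) (Metric.closedBall_mem_nhds x₀ hε) ?_
    ((hF x₀ hx₀).intervalIntegrable a b) hF'x.aestronglyMeasurable
    (Eventually.of_forall fun t ht x hx => hC (x, t) ⟨hx, uIoc_subset_uIcc ht⟩)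
    intervalIntegrable_const
    (Eventually.of_forall fun t _ x hx => hd x (hball hx) t)).2
  filter_upwards [hU.mem_nhds hx₀] with x hx using (hF x hx).aestronglyMeasurable

lemma one_sub_mul_sin_sq_pos {m : ℝ} (hm : m < 1) (θ : ℝ) : 0 < 1 - m * sin θ ^ 2 := by
  rcases le_total m 0 with h | h
  · nlinarith [sq_nonneg (sin θ)]
  · nlinarith [sin_sq_le_one θ]

/-- The integrals `∫ sin²ⁿθ (1 - m sin²θ)ᵃ dθ` over a quarter period; the complete elliptic integral
of the first kind, as a function of the parameter `m = k²`, is the case `n = 0`, `a = -1/2`. -/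
noncomputable def ellInt (n : ℕ) (a m : ℝ) : ℝ :=
  ∫ θ in (0 : ℝ)..(π / 2), (sin θ ^ 2) ^ n * (1 - m * sin θ ^ 2) ^ a

lemma continuous_ellInt_integrand (n : ℕ) (a : ℝ) {m : ℝ} (hm : m < 1) :
    Continuous fun θ => (sin θ ^ 2) ^ n * (1 - m * sin θ ^ 2) ^ a :=
  (by fun_prop : Continuous fun θ => (sin θ ^ 2) ^ n).mul <|
    (by fun_prop : Continuous fun θ => 1 - m * sin θ ^ 2).rpow_const
      fun θ => Or.inl (one_sub_mul_sin_sq_pos hm θ).ne'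

lemma hasDerivAt_ellInt (n : ℕ) (a : ℝ) {m : ℝ} (hm : m < 1) :
    HasDerivAt (ellInt n a) (-a * ellInt (n + 1) (a - 1) m) m := by
  have key := hasDerivAt_intervalIntegral_of_continuousOn (U := Iio 1) isOpen_Iio
    (F := fun m θ => (sin θ ^ 2) ^ n * (1 - m * sin θ ^ 2) ^ a)
    (F' := fun m θ => -a * ((sin θ ^ 2) ^ (n + 1) * (1 - m * sin θ ^ 2) ^ (a - 1)))
    (fun x hx => continuous_ellInt_integrand n a hx) ?_ ?_ 0 (π / 2) hm
  · rwa [intervalIntegral.integral_const_mul] at key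
  · refine continuousOn_const.mul (ContinuousOn.mul (by fun_prop) ?_)
    exact ContinuousOn.rpow_const (by fun_prop)
      fun p hp => Or.inl (one_sub_mul_sin_sq_pos hp.1 p.2).ne'
  · intro x hx θ
    have h1 : HasDerivAt (fun x : ℝ => 1 - x * sin θ ^ 2) (-(sin θ ^ 2)) x := by
      simpa using ((hasDerivAt_id x).mul_const (sin θ ^ 2)).const_sub 1
    refine ((h1.rpow_const (p := a) (Or.inl (one_sub_mul_sin_sq_pos hx θ).ne')).const_mul
      ((sin θ ^ 2) ^ n)).congr_deriv ?_
    ring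

lemma contDiffOn_ellInt (n : ℕ) (a : ℝ) : ContDiffOn ℝ (⊤ : ℕ∞) (ellInt n a) (Iio 1) := by
  rw [contDiffOn_infty]
  intro k
  induction k generalizing n a with
  | zero =>
    exact contDiffOn_zero.2 fun m hm => (hasDerivAt_ellInt n a hm).continuousAt.continuousWithinAt
  | succ k ih =>
    rw [Nat.cast_add, Nat.cast_one, contDiffOn_succ_iff_deriv_of_isOpen isOpen_Iio]
    refine ⟨fun m hm => (hasDerivAt_ellInt n a hm).differentiableAt.differentiableWithinAt,
      by simp, ?_⟩
    exact (contDiffOn_const.mul (ih (n + 1) (a - 1))).congr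
      fun m hm => (hasDerivAt_ellInt n a hm).deriv

lemma Kell_eq_ellInt {k : ℝ} (hk : k ^ 2 < 1) : Kell k = ellInt 0 (-1 / 2) (k ^ 2) := by
  refine intervalIntegral.integral_congr fun θ _ => ?_
  have h := (one_sub_mul_sin_sq_pos hk θ).le
  rw [pow_zero, one_mul, neg_div, rpow_neg h, ← sqrt_eq_rpow, one_div]

/-- Positivity of the combination of `K` and `K'` governing the derivative of the period. -/
lemma ellInt_combination_pos {m : ℝ} (h0 : 0 < m) (h1 : m < 1) :
    0 < 2 * (1 - m + m ^ 2) * ellInt 1 (-1 / 2 - 1) m - (1 - 2 * m) * ellInt 0 (-1 / 2) m := by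
  have hlow : ∫ θ in (0 : ℝ)..(π / 2),
      ((2 * sin θ ^ 2 - 1) * (1 - m / 2) ^ (-1 / 2 - 1 : ℝ) + m) = m * (π / 2) := by
    rw [intervalIntegral.integral_add (Continuous.intervalIntegrable (by fun_prop) _ _)
      intervalIntegrable_const, intervalIntegral.integral_mul_const,
      intervalIntegral.integral_sub (Continuous.intervalIntegrable (by fun_prop) _ _)
      intervalIntegrable_const, intervalIntegral.integral_const_mul, integral_sin_sq]
    simp
    ring_nf
  have hint (n : ℕ) (a : ℝ) : IntervalIntegrable
      (fun θ => (sin θ ^ 2) ^ n * (1 - m * sin θ ^ 2) ^ a) volume 0 (π / 2) :=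
    (continuous_ellInt_integrand n a h1).intervalIntegrable _ _
  rw [ellInt, ellInt, ← intervalIntegral.integral_const_mul, ← intervalIntegral.integral_const_mul,
    ← intervalIntegral.integral_sub ((hint 1 _).const_mul _) ((hint 0 _).const_mul _)]
  refine (by positivity : 0 < m * (π / 2)).trans_le (hlow ▸ ?_)
  refine intervalIntegral.integral_mono_on (by positivity)
    (Continuous.intervalIntegrable (by fun_prop) _ _)
    (((hint 1 _).const_mul _).sub ((hint 0 _).const_mul _)) fun θ _ => ?_
  have hs0 := sq_nonneg (sin θ)
  have hs1 := sin_sq_le_one θ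
  have hpos := one_sub_mul_sin_sq_pos h1 θ
  generalize sin θ ^ 2 = s at *
  have hsplit : (1 - m * s) ^ (-1 / 2 : ℝ) = (1 - m * s) ^ (-1 / 2 - 1 : ℝ) * (1 - m * s) := by
    rw [← rpow_add_one hpos.ne']; norm_num
  have hone : 1 ≤ (1 - m * s) ^ (-1 / 2 - 1 : ℝ) :=
    one_le_rpow_of_pos_of_le_one_of_nonpos hpos (by nlinarith) (by norm_num)
  have hcheb : 0 ≤ (2 * s - 1) *
      ((1 - m * s) ^ (-1 / 2 - 1 : ℝ) - (1 - m / 2) ^ (-1 / 2 - 1 : ℝ)) := by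
    rcases le_total (1 / 2) s with h | h
    · exact mul_nonneg (by linarith) (sub_nonneg.2
        (rpow_le_rpow_of_nonpos hpos (by nlinarith) (by norm_num)))
    · exact mul_nonneg_of_nonpos_of_nonpos (by linarith) (sub_nonpos.2
        (rpow_le_rpow_of_nonpos (by linarith) (by nlinarith) (by norm_num)))
  rw [hsplit]
  generalize (1 - m * s) ^ (-1 / 2 - 1 : ℝ) = w at *
  have : m ≤ m * ((2 - s) * w) := le_mul_of_one_le_right h0.le (by nlinarith)
  linear_combination this + hcheb

lemma one_sub_add_sq_pos (m : ℝ) : 0 < 1 - m + m ^ 2 := by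
  nlinarith [sq_nonneg (2 * m - 1)]

/-- The period of the traveling wave, up to the factor `4 / √c`, as a function of the parameter
`m = κ²`. -/
noncomputable def periodProfile (m : ℝ) : ℝ :=
  ellInt 0 (-1 / 2) m * (1 - m + m ^ 2) ^ (1 / 4 : ℝ)

lemma contDiffOn_periodProfile : ContDiffOn ℝ (⊤ : ℕ∞) periodProfile (Iio 1) :=
  (contDiffOn_ellInt 0 _).mul <|
    (by fun_prop : ContDiff ℝ (⊤ : ℕ∞) fun m : ℝ => 1 - m + m ^ 2).contDiffOn.rpow_const_of_ne
      fun m _ => (one_sub_add_sq_pos m).ne'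

lemma deriv_periodProfile_pos {m : ℝ} (h0 : 0 < m) (h1 : m < 1) : 0 < deriv periodProfile m := by
  have hq := one_sub_add_sq_pos m
  have hd : HasDerivAt (fun m : ℝ => 1 - m + m ^ 2) (2 * m - 1) m :=
    (((hasDerivAt_id m).const_sub 1).add (hasDerivAt_pow 2 m)).congr_deriv (by push_cast; ring)
  have key := (hasDerivAt_ellInt 0 (-1 / 2) h1).mul
    (hd.rpow_const (p := (1 / 4 : ℝ)) (Or.inl hq.ne'))
  rw [show periodProfile = ellInt 0 (-1 / 2) * fun m => (1 - m + m ^ 2) ^ (1 / 4 : ℝ) from rfl,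
    key.deriv]
  have hpow : (1 - m + m ^ 2) ^ (1 / 4 : ℝ) =
      (1 - m + m ^ 2) ^ (1 / 4 - 1 : ℝ) * (1 - m + m ^ 2) := by
    rw [← rpow_add_one hq.ne']; norm_num
  rw [hpow]
  have := mul_pos (rpow_pos_of_pos hq (1 / 4 - 1)) (ellInt_combination_pos h0 h1)
  norm_num at this ⊢
  linear_combination this / 4

lemma strictMonoOn_periodProfile : StrictMonoOn periodProfile (Ico 0 1) := by
  refine strictMonoOn_of_deriv_pos (convex_Ico 0 1)
    (contDiffOn_periodProfile.continuousOn.mono Ico_subset_Iio_self) fun m hm => ?_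
  rw [interior_Ico] at hm
  exact deriv_periodProfile_pos hm.1 hm.2

lemma periodProfile_zero : periodProfile 0 = π / 2 := by
  simp [periodProfile, ellInt]

/-- The logarithmic lower bound for the complete elliptic integral near `m = 1`. -/
lemma log_le_ellInt {δ : ℝ} (h0 : 0 < δ) : log ((δ + π / 2) / δ) ≤ ellInt 0 (-1 / 2) (1 - δ ^ 2) := by
  have hlog : ∫ θ in (0 : ℝ)..(π / 2), (δ + π / 2 - θ)⁻¹ = log ((δ + π / 2) / δ) := by
    rw [intervalIntegral.integral_comp_sub_left (fun x => x⁻¹), add_sub_cancel_right, sub_zero,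
      integral_inv_of_pos h0 (by positivity)]
  have hm : 1 - δ ^ 2 < 1 := sub_lt_self _ (by positivity)
  rw [← hlog]
  refine intervalIntegral.integral_mono_on (by positivity)
    (ContinuousOn.intervalIntegrable ?_)
    ((continuous_ellInt_integrand 0 (-1 / 2) hm).intervalIntegrable _ _) fun θ hθ => ?_
  · refine ContinuousOn.inv₀ (by fun_prop) fun θ hθ => ?_
    rw [uIcc_of_le (by positivity)] at hθ
    linarith [hθ.2]
  · have hp := one_sub_mul_sin_sq_pos hm θ
    have hcos : cos θ ≤ π / 2 - θ := by
      rw [← sin_pi_div_two_sub]; exact sin_le (by linarith [hθ.2])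
    have hcos0 : 0 ≤ cos θ := cos_nonneg_of_mem_Icc ⟨by linarith [hθ.1, pi_pos], hθ.2⟩
    rw [pow_zero, one_mul, neg_div, rpow_neg hp.le, ← sqrt_eq_rpow]
    refine inv_anti₀ (sqrt_pos.2 hp) (sqrt_le_iff.2 ⟨by linarith [hθ.2], ?_⟩)
    nlinarith [sin_sq_add_cos_sq θ, sq_nonneg (cos θ), mul_nonneg (sq_nonneg δ) (sq_nonneg (cos θ)),
      mul_nonneg h0.le (sub_nonneg.2 hθ.2)]

lemma exists_lt_periodProfile (T : ℝ) : ∃ m ∈ Ico (0 : ℝ) 1, T < periodProfile m := by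
  have hδ : 0 < exp (-(2 * |T|)) := exp_pos _
  have hδ1 : exp (-(2 * |T|)) ≤ 1 := exp_le_one_iff.2 (by linarith [abs_nonneg T])
  have hlog := log_le_ellInt hδ
  generalize hδ_def : exp (-(2 * |T|)) = δ at *
  have hδT : 2 * |T| < log ((δ + π / 2) / δ) := by
    rw [lt_log_iff_exp_lt (by positivity), lt_div_iff₀ hδ, ← hδ_def, ← exp_add]
    simp only [add_neg_cancel, exp_zero]
    linarith [pi_gt_three, exp_pos (-(2 * |T|))]
  refine ⟨1 - δ ^ 2, ⟨by nlinarith, by nlinarith⟩, ?_⟩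
  have hq : (1 / 2 : ℝ) ≤ (1 - (1 - δ ^ 2) + (1 - δ ^ 2) ^ 2) ^ (1 / 4 : ℝ) := by
    have h := rpow_le_rpow (z := 1 / 4) (by norm_num) (show (1 / 2 : ℝ) ^ 4 ≤
      1 - (1 - δ ^ 2) + (1 - δ ^ 2) ^ 2 by nlinarith [sq_nonneg (2 * (1 - δ ^ 2) - 1)]) (by norm_num)
    rwa [← rpow_natCast, ← rpow_mul (by norm_num), show ((4 : ℕ) : ℝ) * (1 / 4) = 1 by norm_num,
      rpow_one] at h
  rw [periodProfile]
  nlinarith [le_abs_self T, abs_nonneg T]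

lemma exists_periodProfile_eq {T : ℝ} (hT : π / 2 < T) : ∃ m ∈ Ioo (0 : ℝ) 1, periodProfile m = T := by
  obtain ⟨b, hb, hTb⟩ := exists_lt_periodProfile T
  have hcont : ContinuousOn periodProfile (Icc 0 b) :=
    contDiffOn_periodProfile.continuousOn.mono fun x hx => hx.2.trans_lt hb.2
  obtain ⟨m, hm, rfl⟩ := intermediate_value_Ioo hb.1 hcont ⟨periodProfile_zero ▸ hT, hTb⟩
  exact ⟨m, ⟨hm.1, hm.2.trans hb.2⟩, rfl⟩

/-- A function with nonvanishing derivative and injective on an open set has a smooth inverse. -/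
lemma contDiffOn_of_rightInverse {f g : ℝ → ℝ} {s t : Set ℝ} (hs : IsOpen s)
    (hf : ContDiffOn ℝ (⊤ : ℕ∞) f s) (hf' : ∀ x ∈ s, deriv f x ≠ 0) (hinj : InjOn f s)
    (hg : ∀ y ∈ t, g y ∈ s ∧ f (g y) = y) (ht : IsOpen t) : ContDiffOn ℝ (⊤ : ℕ∞) g t := by
  intro y hy
  obtain ⟨hgs, hgy⟩ := hg y hy
  have hfx := hf.contDiffAt (hs.mem_nhds hgs)
  let e := ContinuousLinearEquiv.unitsEquivAut ℝ (Units.mk0 _ (hf' _ hgs))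
  have hd : HasFDerivAt f (e : ℝ →L[ℝ] ℝ) (g y) :=
    ((hfx.differentiableAt (by simp)).hasDerivAt.hasFDerivAt).congr_fderiv (by ext; simp [e])
  have hloc := hfx.to_localInverse hd (by simp)
  have hstrict := hfx.hasStrictFDerivAt' hd (by simp)
  have hcont := hloc.continuousAt
  have hval := hfx.localInverse_apply_image hd (by simp)
  rw [ContinuousAt, hval, hgy] at hcont
  have hright := hstrict.eventually_right_inverse
  rw [hgy] at hloc hright
  refine (hloc.congr_of_eventuallyEq ?_).contDiffWithinAt
  filter_upwards [hcont.eventually (hs.mem_nhds hgs), hright, ht.mem_nhds hy] with z hz hfz hzt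
  exact hinj (hg z hzt).1 hz ((hg z hzt).2.trans hfz.symm)

/-- The rescaled amplitude `η / c` as a function of the parameter `m = κ²`. -/
noncomputable def amplitudeRatio (m : ℝ) : ℝ :=
  √((8 + 4 * (2 * m - 1) / √(1 - m + m ^ 2)) / 3)

lemma ratio_mem_Ioo {m : ℝ} (hm : m ∈ Ioo (0 : ℝ) 1) :
    (2 * m - 1) / √(1 - m + m ^ 2) ∈ Ioo (-1 : ℝ) 1 := by
  have hu := sqrt_pos.2 (one_sub_add_sq_pos m)
  refine abs_lt.1 ?_
  rw [abs_div, abs_of_pos hu, div_lt_one hu]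
  refine lt_sqrt_of_sq_lt ?_
  rw [sq_abs]
  nlinarith [mul_pos hm.1 (sub_pos.2 hm.2)]

lemma amplitudeRatio_sq {m : ℝ} (hm : m ∈ Ioo (0 : ℝ) 1) :
    amplitudeRatio m ^ 2 = (8 + 4 * (2 * m - 1) / √(1 - m + m ^ 2)) / 3 := by
  have := (ratio_mem_Ioo hm).1
  rw [amplitudeRatio, sq_sqrt]
  rw [mul_div_assoc]; linarith

lemma contDiffOn_amplitudeRatio : ContDiffOn ℝ (⊤ : ℕ∞) amplitudeRatio (Ioo 0 1) := by
  have hu : ContDiffOn ℝ (⊤ : ℕ∞) (fun m : ℝ => √(1 - m + m ^ 2)) (Ioo 0 1) :=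
    ContDiffOn.sqrt (by fun_prop) fun m _ => (one_sub_add_sq_pos m).ne'
  refine ContDiffOn.sqrt ((contDiffOn_const.add (ContDiffOn.div (by fun_prop) hu
    fun m _ => (sqrt_pos.2 (one_sub_add_sq_pos m)).ne')).div_const 3) fun m hm => ?_
  have := (ratio_mem_Ioo hm).1
  rw [mul_div_assoc]
  linarith

lemma amplitude_mem_Ioo {c m : ℝ} (hc : 0 < c) (hm : m ∈ Ioo (0 : ℝ) 1) :
    c * amplitudeRatio m ∈ Ioo (2 * c / √3) (2 * c) := by
  obtain ⟨h1, h2⟩ := ratio_mem_Ioo hm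
  have hsq := amplitudeRatio_sq hm
  have h0 : 0 ≤ amplitudeRatio m := sqrt_nonneg _
  rw [mul_div_assoc] at hsq
  have hl : 2 / √3 < amplitudeRatio m := by
    refine lt_of_pow_lt_pow_left₀ 2 h0 ?_
    rw [div_pow, sq_sqrt (by norm_num), hsq]
    linarith
  have hr : amplitudeRatio m < 2 := lt_of_pow_lt_pow_left₀ 2 (by norm_num) (by rw [hsq]; linarith)
  constructor
  · rw [mul_comm 2 c, mul_div_assoc]
    exact mul_lt_mul_of_pos_left hl hc
  · rw [mul_comm 2 c]
    exact mul_lt_mul_of_pos_left hr hc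

lemma exists_eq_mul_amplitudeRatio {c η : ℝ} (hc : 0 < c) (hη : η ∈ Ioo (2 * c / √3) (2 * c)) :
    ∃ m ∈ Ioo (0 : ℝ) 1, η = c * amplitudeRatio m := by
  obtain ⟨h1, h2⟩ := hη
  have hη0 : 0 < η := lt_trans (by positivity) h1
  have hlow : 4 * c ^ 2 < 3 * η ^ 2 := by
    have h := pow_lt_pow_left₀ h1 (by positivity) two_ne_zero
    rw [div_pow, sq_sqrt (by norm_num)] at h
    linarith
  have hup : η ^ 2 < 4 * c ^ 2 := by nlinarith
  obtain ⟨y, hy⟩ : ∃ y, y = 3 * η ^ 2 - 8 * c ^ 2 := ⟨_, rfl⟩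
  have hr : 3 * rfun η c = 64 * c ^ 4 - y ^ 2 := by rw [rfun, hy]; ring
  have hy2 : y ^ 2 < (4 * c ^ 2) ^ 2 := sq_lt_sq' (by linarith) (by linarith)
  have hr0 : 0 < rfun η c := by nlinarith [pow_pos hc 4]
  have hR := sqrt_pos.2 hr0
  have hR2 := sq_sqrt hr0.le
  generalize √(rfun η c) = R at *
  have hyR : |y| < R := abs_lt_of_sq_lt_sq (by nlinarith) hR.le
  obtain ⟨hyR1, hyR2⟩ := abs_lt.1 hyR
  have hq : 1 - (1 / 2 + y / (2 * R)) + (1 / 2 + y / (2 * R)) ^ 2 = (4 * c ^ 2 / R) ^ 2 := by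
    field_simp
    linear_combination 3 * hR2 + hr
  refine ⟨1 / 2 + y / (2 * R), ⟨?_, ?_⟩, ?_⟩
  · have : -(1 / 2) < y / (2 * R) := by rw [lt_div_iff₀ (by positivity)]; linarith
    linarith
  · have : y / (2 * R) < 1 / 2 := by rw [div_lt_iff₀ (by positivity)]; linarith
    linarith
  · rw [amplitudeRatio, hq, sqrt_sq (by positivity)]
    have : (8 + 4 * (2 * (1 / 2 + y / (2 * R)) - 1) / (4 * c ^ 2 / R)) / 3 = (η / c) ^ 2 := by
      field_simp
      linear_combination hy
    rw [this, sqrt_sq (by positivity)]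
    field_simp

/-- The period in terms of the parameter `m`. -/
lemma Gfun_mul_amplitudeRatio {c m : ℝ} (hc : 0 < c) (hm : m ∈ Ioo (0 : ℝ) 1) :
    Gfun (c * amplitudeRatio m) c = 4 * periodProfile m / √c := by
  have hq := one_sub_add_sq_pos m
  have hu := sqrt_pos.2 hq
  have hu2 := sq_sqrt hq.le
  have hsq := amplitudeRatio_sq hm
  have hr : rfun (c * amplitudeRatio m) c = (2 * c) ^ 4 / (1 - m + m ^ 2) := by
    rw [rfun, mul_pow, mul_pow, show amplitudeRatio m ^ 4 = (amplitudeRatio m ^ 2) ^ 2 by ring, hsq,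
      ← hu2, sqrt_sq hu.le]
    generalize √(1 - m + m ^ 2) = u at *
    field_simp
    linear_combination 64 * hu2
  have hR : √(rfun (c * amplitudeRatio m) c) = 4 * c ^ 2 / √(1 - m + m ^ 2) := by
    rw [hr, sqrt_div (by positivity), show (2 * c) ^ 4 = (4 * c ^ 2) ^ 2 by ring,
      sqrt_sq (by positivity)]
  have hk : kfun (c * amplitudeRatio m) c ^ 2 = m := by
    have : (3 * (c * amplitudeRatio m) ^ 2 - 8 * c ^ 2 + √(rfun (c * amplitudeRatio m) c)) /
        (2 * √(rfun (c * amplitudeRatio m) c)) = m := by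
      rw [hR, mul_pow, hsq]
      field_simp
      ring
    rw [kfun, this, sq_sqrt hm.1.le]
  have hr4 : rfun (c * amplitudeRatio m) c ^ (1 / 4 : ℝ) =
      2 * c / (1 - m + m ^ 2) ^ (1 / 4 : ℝ) := by
    rw [hr, div_rpow (by positivity) hq.le, ← rpow_natCast, ← rpow_mul (by positivity)]
    norm_num
  rw [Gfun, Kell_eq_ellInt (hk.trans_lt hm.2), hk, hr4, periodProfile]
  have := rpow_pos_of_pos hq (1 / 4)
  have hc2 := sq_sqrt hc.le
  have hsc := sqrt_pos.2 hc
  field_simp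
  rw [hc2]
  ring

lemma Gfun_mul_amplitudeRatio_eq_iff {L c m : ℝ} (hc : 0 < c) (hm : m ∈ Ioo (0 : ℝ) 1) :
    Gfun (c * amplitudeRatio m) c = L ↔ periodProfile m = √c * L / 4 := by
  rw [Gfun_mul_amplitudeRatio hc hm, div_eq_iff (sqrt_pos.2 hc).ne']
  constructor <;> intro h <;> linarith

lemma pi_div_two_lt_of_speed {L c : ℝ} (hL : 0 < L) (hc : 4 * π ^ 2 / L ^ 2 < c) :
    π / 2 < √c * L / 4 := by
  have : 2 * π / L < √c := lt_sqrt_of_sq_lt (by rw [div_pow]; convert hc using 2; ring)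
  rw [div_lt_iff₀ hL] at this
  linarith

/-- For every speed c > 4π²/L² there is a unique amplitude η ∈ (2c/√3, 2c) giving an
L-periodic wave, and the resulting map Γ : c ↦ η(c) is smooth with G(Γ(c), c) = L. -/
theorem dsw_amplitude_selection
    (L : ℝ) (hL : 0 < L) :
    (∀ c : ℝ, 4 * Real.pi ^ 2 / L ^ 2 < c →
      ∃! η : ℝ, η ∈ Set.Ioo (2 * c / Real.sqrt 3) (2 * c) ∧ Gfun η c = L) ∧
    ∃ Γ : ℝ → ℝ,
      ContDiffOn ℝ (⊤ : ℕ∞) Γ (Set.Ioi (4 * Real.pi ^ 2 / L ^ 2)) ∧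
      ∀ c ∈ Set.Ioi (4 * Real.pi ^ 2 / L ^ 2),
        Γ c ∈ Set.Ioo (2 * c / Real.sqrt 3) (2 * c) ∧ Gfun (Γ c) c = L := by
  have hpos : ∀ c, 4 * π ^ 2 / L ^ 2 < c → 0 < c := fun c hc => lt_trans (by positivity) hc
  have hex : ∀ T : ℝ, ∃ m, π / 2 < T → m ∈ Ioo (0 : ℝ) 1 ∧ periodProfile m = T := fun T => by
    by_cases hT : π / 2 < T
    · obtain ⟨m, hm⟩ := exists_periodProfile_eq hT
      exact ⟨m, fun _ => hm⟩
    · exact ⟨0, fun h => absurd h hT⟩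
  choose Φ hΦ using hex
  have hinj : InjOn periodProfile (Ioo 0 1) :=
    (strictMonoOn_periodProfile.mono Ioo_subset_Ico_self).injOn
  have hΦ_smooth : ContDiffOn ℝ (⊤ : ℕ∞) Φ (Ioi (π / 2)) :=
    contDiffOn_of_rightInverse isOpen_Ioo (contDiffOn_periodProfile.mono Ioo_subset_Iio_self)
      (fun m hm => (deriv_periodProfile_pos hm.1 hm.2).ne') hinj hΦ isOpen_Ioi
  have hΓ : ∀ c, 4 * π ^ 2 / L ^ 2 < c →
      c * amplitudeRatio (Φ (√c * L / 4)) ∈ Ioo (2 * c / √3) (2 * c) ∧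
        Gfun (c * amplitudeRatio (Φ (√c * L / 4))) c = L := fun c hc => by
    obtain ⟨hm, h⟩ := hΦ _ (pi_div_two_lt_of_speed hL hc)
    exact ⟨amplitude_mem_Ioo (hpos c hc) hm,
      (Gfun_mul_amplitudeRatio_eq_iff (hpos c hc) hm).2 h⟩
  refine ⟨fun c hc => ⟨_, hΓ c hc, ?_⟩, fun c => c * amplitudeRatio (Φ (√c * L / 4)), ?_, hΓ⟩
  · rintro η ⟨hη, hG⟩
    obtain ⟨m, hm, rfl⟩ := exists_eq_mul_amplitudeRatio (hpos c hc) hη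
    rw [Gfun_mul_amplitudeRatio_eq_iff (hpos c hc) hm] at hG
    obtain ⟨hm', h⟩ := hΦ _ (pi_div_two_lt_of_speed hL hc)
    rw [hinj hm hm' (hG.trans h.symm)]
  · have hT : ContDiffOn ℝ (⊤ : ℕ∞) (fun c => √c * L / 4) (Ioi (4 * π ^ 2 / L ^ 2)) :=
      ((ContDiffOn.sqrt contDiffOn_id fun c hc => (hpos c hc).ne').mul contDiffOn_const).div_const 4
    exact contDiffOn_id.mul <| contDiffOn_amplitudeRatio.comp
      (hΦ_smooth.comp hT fun c hc => pi_div_two_lt_of_speed hL hc)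
      fun c hc => (hΦ _ (pi_div_two_lt_of_speed hL hc)).1
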